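/- arXiv:1104.4243 — 6 statements merged into one kernel-verified Lean document; each statement's English description precedes it below -/
import Mathlib

section
/- Let φ̃ : V → ℝ be a nonnegative, convex, continuous function with bounded sublevel sets, and let φ : V → ℝ be a continuous function such that there exist λ ≥ 0 for which v ↦ φ(v) + (λ/2)‖j(v)‖²_H is convex on V, and constants C₁ > 0, C₂ ∈ ℝ with C₁ φ̃(v) − C₂ ≤ φ(v) for all v ∈ V. Then the extensions of both φ and φ̃ to H (by +∞ outside the range of j) are lower semicontinuous functions on H. -/
open Filter Topology

/-- In a reflexive space, an ultrafilter containing a bounded set converges weakly. -/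
theorem Ultrafilter.exists_forall_tendsto_dual {V : Type*} [NormedAddCommGroup V]
    [NormedSpace ℝ V] (hrefl : Function.Surjective (NormedSpace.inclusionInDoubleDual ℝ V))
    (U : Ultrafilter V) {s : Set V} (hs : Bornology.IsBounded s) (hsU : s ∈ U) :
    ∃ v : V, ∀ f : StrongDual ℝ V, Tendsto f U (𝓝 (f v)) := by
  obtain ⟨R, hR⟩ := hs.exists_norm_le
  let J : V → WeakDual ℝ (StrongDual ℝ V) := fun v =>
    StrongDual.toWeakDual (NormedSpace.inclusionInDoubleDual ℝ V v)
  have hmem : ∀ v ∈ s, J v ∈ WeakDual.toStrongDual ⁻¹'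
      Metric.closedBall (0 : StrongDual ℝ (StrongDual ℝ V)) R := fun v hv =>
    (dist_zero_right (NormedSpace.inclusionInDoubleDual ℝ V v)).trans_le
      ((NormedSpace.double_dual_bound ℝ V v).trans (hR v hv))
  obtain ⟨ξ, -, hξ⟩ := (WeakDual.isCompact_closedBall
    (0 : StrongDual ℝ (StrongDual ℝ V)) R).ultrafilter_le_nhds' (U.map J)
      (Ultrafilter.mem_map.2 (Filter.mem_of_superset hsU hmem))
  obtain ⟨v, hv⟩ := hrefl (WeakDual.toStrongDual ξ)
  refine ⟨v, fun f => ?_⟩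
  have hfv : f v = ξ f := DFunLike.congr_fun hv f
  rw [hfv]
  exact ((WeakDual.eval_continuous f).tendsto ξ).comp hξ

/-- A closed convex set contains every weak limit of a filter to which it belongs. -/
theorem Convex.mem_of_forall_tendsto_dual {V : Type*} [NormedAddCommGroup V]
    [NormedSpace ℝ V] {s : Set V} (hconv : Convex ℝ s) (hclosed : IsClosed s)
    {F : Filter V} [F.NeBot] (hs : s ∈ F) {v : V}
    (hv : ∀ f : StrongDual ℝ V, Tendsto f F (𝓝 (f v))) : v ∈ s := by
  by_contra hvs
  obtain ⟨f, u, hfu, huv⟩ := geometric_hahn_banach_closed_point hconv hclosed hvs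
  exact huv.not_ge (le_of_tendsto (hv f) (Filter.mem_of_superset hs fun x hx => (hfu x hx).le))

/-- The extension by `⊤` of a continuous function with bounded sublevel sets, convex up to a
multiple of the squared norm pulled back by `j`, is lower semicontinuous. -/
theorem lowerSemicontinuous_extend_top {V H : Type*} [NormedAddCommGroup V] [NormedSpace ℝ V]
    [NormedAddCommGroup H] [InnerProductSpace ℝ H]
    (hrefl : Function.Surjective (NormedSpace.inclusionInDoubleDual ℝ V))
    (j : V →L[ℝ] H) (hj : Function.Injective j) (φ : V → ℝ) (hφ_cont : Continuous φ) (l : ℝ)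
    (hconv : ConvexOn ℝ Set.univ (fun v => φ v + (l / 2) * ‖j v‖ ^ 2))
    (hbdd : ∀ c : ℝ, Bornology.IsBounded {v : V | φ v ≤ c}) :
    LowerSemicontinuous
      (Function.extend (⇑j) (fun v => (φ v : EReal)) (fun _ => (⊤ : EReal))) := by
  intro h y hy
  by_contra hcon
  have hfreq : ∃ᶠ v in comap j (𝓝 h), (φ v : EReal) ≤ y := by
    rw [frequently_comap]
    refine (not_eventually.1 hcon).mono fun h' hh' => ?_
    rw [not_lt] at hh'
    by_cases hr : ∃ v, j v = h'
    · obtain ⟨v, rfl⟩ := hr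
      exact ⟨v, rfl, by rwa [hj.extend_apply] at hh'⟩
    · rw [Function.extend_apply' _ _ _ hr] at hh'
      exact absurd (hy.trans_le le_top) hh'.not_gt
  obtain ⟨v₀, hv₀⟩ := hfreq.exists
  lift y to ℝ using ⟨(hy.trans_le le_top).ne, fun hb => by simp [hb] at hv₀⟩
  simp only [EReal.coe_le_coe_iff] at hfreq
  obtain ⟨U, hU⟩ := exists_ultrafilter_iff.2 (frequently_iff_neBot.1 hfreq)
  obtain ⟨hU, hUy⟩ := le_inf_iff.1 hU
  rw [le_principal_iff] at hUy
  have hjU : Tendsto j U (𝓝 h) := tendsto_iff_comap.2 hU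
  obtain ⟨v, hv⟩ := U.exists_forall_tendsto_dual hrefl (hbdd y) hUy
  obtain rfl : j v = h := by
    rw [SeparatingDual.eq_iff_forall_dual_eq (R := ℝ)]
    exact fun g => tendsto_nhds_unique (hv (g.comp j)) ((g.continuous.tendsto h).comp hjU)
  rw [hj.extend_apply, gt_iff_lt, EReal.coe_lt_coe_iff] at hy
  refine hy.not_ge (le_of_forall_pos_le_add fun ε hε => ?_)
  have hnorm : Tendsto (fun x => (l / 2) * ‖j x‖ ^ 2) U (𝓝 ((l / 2) * ‖j v‖ ^ 2)) :=
    (hjU.norm.pow 2).const_mul _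
  have hlevel : {x | φ x + (l / 2) * ‖j x‖ ^ 2 ≤ y + (l / 2) * ‖j v‖ ^ 2 + ε} ∈ (U : Filter V) := by
    filter_upwards [hUy, hnorm.eventually_lt_const (lt_add_of_pos_right _ hε)] with x hx hx'
    linarith
  have hmem := Convex.mem_of_forall_tendsto_dual (by simpa using hconv.convex_le _)
    (isClosed_le (by fun_prop) continuous_const) hlevel hv
  simp only [Set.mem_ofPred_eq] at hmem
  linarith

/-- If `φ̃ : V → ℝ` is nonnegative, convex, continuous with bounded sublevel
sets on a reflexive Banach space `V`, and `φ : V → ℝ` is continuous, quasi-convex with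
respect to the Hilbertian norm pulled back by an injective continuous linear map
`j : V → H`, and `C₁ φ̃ - C₂ ≤ φ`, then the extensions of `φ` and `φ̃` to `H` by `+∞`
outside the range of `j` are lower semicontinuous on `H`. -/
theorem lsc_of_extensions
    {V H : Type*} [NormedAddCommGroup V] [NormedSpace ℝ V] [CompleteSpace V]
    [NormedAddCommGroup H] [InnerProductSpace ℝ H]
    (hrefl : Function.Surjective (NormedSpace.inclusionInDoubleDual ℝ V))
    (j : V →L[ℝ] H) (hj : Function.Injective j)
    (φt : V → ℝ) (hφt_nonneg : ∀ v, 0 ≤ φt v)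
    (hφt_conv : ConvexOn ℝ Set.univ φt) (hφt_cont : Continuous φt)
    (hφt_sublevel : ∀ c : ℝ, Bornology.IsBounded {v : V | φt v ≤ c})
    (φ : V → ℝ) (hφ_cont : Continuous φ)
    (hφ_quasi : ∃ l : ℝ, 0 ≤ l ∧
      ConvexOn ℝ Set.univ (fun v => φ v + (l / 2) * ‖j v‖ ^ 2))
    (C₁ C₂ : ℝ) (hC₁ : 0 < C₁) (hbound : ∀ v, C₁ * φt v - C₂ ≤ φ v) :
    LowerSemicontinuous
      (Function.extend (⇑j) (fun v => (φ v : EReal)) (fun _ => (⊤ : EReal))) ∧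
    LowerSemicontinuous
      (Function.extend (⇑j) (fun v => (φt v : EReal)) (fun _ => (⊤ : EReal))) := by
  obtain ⟨l, -, hl⟩ := hφ_quasi
  refine ⟨lowerSemicontinuous_extend_top hrefl j hj φ hφ_cont l hl fun c =>
      (hφt_sublevel ((c + C₂) / C₁)).subset fun v hv => ?_,
    lowerSemicontinuous_extend_top hrefl j hj φt hφt_cont 0 (by simpa using hφt_conv)
      hφt_sublevel⟩
  rw [Set.mem_ofPred_eq] at hv ⊢
  rw [le_div_iff₀ hC₁]
  linarith [hbound v]
end

section
/- Let f : E → ℝ be nonnegative, convex on all of E, even, and subhomogeneous with constant C. Let F ⊆ E be a subset with 0 ∈ F, let v ∈ E, and let h ∈ F be a best approximation of v in F with respect to f, i.e. f(v − h) ≤ f(v − g) for all g ∈ F. Then f(h) ≤ C f(v). -/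
/-- If `f : E → ℝ` is nonnegative, convex, even and subhomogeneous with
constant `C`, `F ⊆ E` contains `0`, and `h ∈ F` is a best approximation of `v` in `F`
with respect to `f`, then `f h ≤ C * f v`. -/
theorem best_approximation_bound
    {E : Type*} [AddCommGroup E] [Module ℝ E]
    (f : E → ℝ) (C : ℝ)
    (hnonneg : ∀ x, 0 ≤ f x)
    (hconv : ConvexOn ℝ Set.univ f)
    (heven : ∀ x : E, f (-x) = f x)
    (hsub : ∀ x : E, f ((2 : ℝ) • x) ≤ C * f x)
    (F : Set E) (h0F : (0 : E) ∈ F)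
    (v : E) (h : E) (hhF : h ∈ F)
    (hbest : ∀ g ∈ F, f (v - h) ≤ f (v - g)) :
    f h ≤ C * f v := by
  have hmid : f h ≤ (1 / 2 : ℝ) * f ((2 : ℝ) • v) + (1 / 2 : ℝ) * f ((2 : ℝ) • (h - v)) := by
    have key := hconv.2 (Set.mem_univ ((2 : ℝ) • v)) (Set.mem_univ ((2 : ℝ) • (h - v)))
      (by norm_num : (0 : ℝ) ≤ 1 / 2) (by norm_num : (0 : ℝ) ≤ 1 / 2) (by norm_num)
    have hsplit : (1 / 2 : ℝ) • (2 : ℝ) • v + (1 / 2 : ℝ) • (2 : ℝ) • (h - v) = h := by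
      module
    rwa [hsplit, smul_eq_mul, smul_eq_mul] at key
  have hdist : f (h - v) ≤ f v := by
    rw [← heven (h - v), neg_sub]
    simpa using hbest 0 h0F
  have hv := hsub v
  have hhv := hsub (h - v)
  rcases le_or_gt 0 C with hC | hC
  · have := mul_le_mul_of_nonneg_left hdist hC
    linarith
  · have hzero : ∀ x, f x = 0 := fun x =>
      le_antisymm (nonpos_of_mul_nonneg_right ((hnonneg _).trans (hsub x)) hC) (hnonneg x)
    simp [hzero]
end

section
/- Let φ : H → [0, ∞] be lower semicontinuous, and let uₙ, u : Ω → H be a.e.-measurable functions such that uₙ → u in measure. Then ∫ φ(u(ω)) dμ(ω) ≤ liminf_{n→∞} ∫ φ(uₙ(ω)) dμ(ω), where the integrals are Lebesgue integrals with values in [0, ∞]. -/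
open MeasureTheory Filter Topology ENNReal

/-- If `φ : H → [0,∞]` is lower semicontinuous and `uₙ → u` in measure
(with `uₙ, u` a.e.-measurable), then `∫ φ(u) dμ ≤ liminf ∫ φ(uₙ) dμ`. -/
theorem lintegral_lsc_le_liminf_of_tendstoInMeasure
    {Ω H : Type*} [MeasurableSpace Ω] {μ : Measure Ω}
    [MetricSpace H] [MeasurableSpace H] [BorelSpace H]
    [TopologicalSpace.SeparableSpace H]
    (φ : H → ℝ≥0∞) (hφ : LowerSemicontinuous φ)
    (u : Ω → H) (uN : ℕ → Ω → H)
    (hu : AEMeasurable u μ) (huN : ∀ n, AEMeasurable (uN n) μ)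
    (hconv : TendstoInMeasure μ uN atTop u) :
    ∫⁻ ω, φ (u ω) ∂μ ≤ atTop.liminf fun n => ∫⁻ ω, φ (uN n ω) ∂μ := by
  by_contra! hlt
  obtain ⟨a, hla, hau⟩ := exists_between hlt
  obtain ⟨ns, hns, hnsa⟩ := extraction_of_frequently_atTop (frequently_lt_of_liminf_lt (h := hla))
  obtain ⟨ms, -, hms⟩ := TendstoInMeasure.exists_seq_tendsto_ae
    (fun ε hε => (hconv ε hε).comp hns.tendsto_atTop : TendstoInMeasure μ (uN ∘ ns) atTop u)
  refine hau.not_ge ?_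
  calc ∫⁻ ω, φ (u ω) ∂μ
      ≤ ∫⁻ ω, atTop.liminf (fun k => φ (uN (ns (ms k)) ω)) ∂μ := by
        refine lintegral_mono_ae ?_
        filter_upwards [hms] with ω hω
        exact (hφ.le_liminf (u ω)).trans (liminf_le_liminf_of_le hω)
    _ ≤ atTop.liminf (fun k => ∫⁻ ω, φ (uN (ns (ms k)) ω) ∂μ) :=
        lintegral_liminf_le' fun k => hφ.measurable.comp_aemeasurable (huN _)
    _ ≤ a := liminf_le_of_le (h := fun b hb => by
        obtain ⟨k, hk⟩ := hb.exists
        exact hk.trans (hnsa (ms k)).le)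
end

section
/- Let p > 1 and c₂ > 0. Let x : E → ℝ be measurable with ∫ |x|^{p+1} dm < ∞, let g : E → ℝ be measurable with 0 ≤ g(ξ) ≤ c₂(1 + |x(ξ)|^{p−1}) for m-a.e. ξ, and let (w_k)_{k∈ℕ} be a sequence of measurable functions E → ℝ. Then there exists a constant C, depending only on c₂, p and m(E), such that ∑_{k=1}^∞ ∫_E g·w_k² dm ≤ C (1 + ∫_E |x|^{p+1} dm + (∑_{k=1}^∞ ‖w_k‖_{p+1}²)^{(p+1)/2}). -/
open MeasureTheory ENNReal

/-- A weighted `L²` sum is bounded via Hölder's and Young's inequalities. -/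
theorem tsum_lintegral_mul_le_lintegral_rpow_add {E : Type*} [MeasurableSpace E]
    (m : Measure E) {P Q : ℝ} (h : Q.HolderConjugate P) {G : E → ℝ≥0∞} {W : ℕ → E → ℝ≥0∞}
    (hG : AEMeasurable G m) (hW : ∀ k, AEMeasurable (W k) m) :
    ∑' k, ∫⁻ ξ, G ξ * W k ξ ∂m ≤
      ∫⁻ ξ, G ξ ^ Q ∂m + (∑' k, (∫⁻ ξ, W k ξ ^ P ∂m) ^ (1 / P)) ^ P := by
  calc
    _ ≤ ∑' k, (∫⁻ ξ, G ξ ^ Q ∂m) ^ (1 / Q) * (∫⁻ ξ, W k ξ ^ P ∂m) ^ (1 / P) :=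
      ENNReal.tsum_le_tsum fun k ↦ ENNReal.lintegral_mul_le_Lp_mul_Lq m h hG (hW k)
    _ = (∫⁻ ξ, G ξ ^ Q ∂m) ^ (1 / Q) * ∑' k, (∫⁻ ξ, W k ξ ^ P ∂m) ^ (1 / P) :=
      ENNReal.tsum_mul_left
    _ ≤ _ := ENNReal.young_inequality _ _ h
    _ ≤ _ := by
      rw [← ENNReal.rpow_mul, one_div_mul_cancel h.ne_zero, ENNReal.rpow_one]
      gcongr
      · exact (ENNReal.div_le_div_left (ENNReal.one_le_ofReal.2 h.lt.le) _).trans_eq (div_one _)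
      · exact (ENNReal.div_le_div_left (ENNReal.one_le_ofReal.2 h.symm.lt.le) _).trans_eq
          (div_one _)

theorem lintegral_ofReal_sq_rpow_eq_eLpNorm_sq {E : Type*} [MeasurableSpace E] (m : Measure E)
    {p : ℝ} (hp : 0 < p) (w : E → ℝ) :
    (∫⁻ ξ, ENNReal.ofReal (w ξ ^ 2) ^ (p / 2) ∂m) ^ (1 / (p / 2)) =
      eLpNorm w (ENNReal.ofReal p) m ^ 2 := by
  rw [eLpNorm_eq_lintegral_rpow_enorm_toReal (by simpa using hp) ENNReal.ofReal_ne_top,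
    ENNReal.toReal_ofReal hp.le, ← ENNReal.rpow_natCast, ← ENNReal.rpow_mul]
  congr 1
  · refine lintegral_congr fun ξ ↦ ?_
    rw [← sq_abs, ENNReal.ofReal_pow (abs_nonneg _), ← Real.enorm_eq_ofReal_abs,
      ← ENNReal.rpow_natCast, ← ENNReal.rpow_mul]
    congr 1
    push_cast
    ring
  · push_cast
    field_simp

theorem ofReal_rpow_le_of_le_mul_one_add_rpow {p c g x : ℝ} (hp : 1 < p) (hc : 0 ≤ c)
    (hg : g ≤ c * (1 + |x| ^ (p - 1))) :
    ENNReal.ofReal g ^ ((p + 1) / (p - 1)) ≤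
      ENNReal.ofReal c ^ ((p + 1) / (p - 1)) * 2 ^ ((p + 1) / (p - 1) - 1) *
        (1 + ENNReal.ofReal (|x| ^ (p + 1))) := by
  have hp' : 0 < p - 1 := sub_pos.2 hp
  have hQ : 1 ≤ (p + 1) / (p - 1) := by
    rw [le_div_iff₀ hp']
    linarith
  have hpow : ENNReal.ofReal (|x| ^ (p - 1)) ^ ((p + 1) / (p - 1)) =
      ENNReal.ofReal (|x| ^ (p + 1)) := by
    rw [ENNReal.ofReal_rpow_of_nonneg (by positivity) (by positivity),
      ← Real.rpow_mul (abs_nonneg _), mul_div_cancel₀ _ hp'.ne']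
  calc
    _ ≤ (ENNReal.ofReal c * (1 + ENNReal.ofReal (|x| ^ (p - 1)))) ^ ((p + 1) / (p - 1)) := by
      rw [← ENNReal.ofReal_one, ← ENNReal.ofReal_add zero_le_one (by positivity),
        ← ENNReal.ofReal_mul hc]
      gcongr
    _ = ENNReal.ofReal c ^ ((p + 1) / (p - 1)) *
        (1 + ENNReal.ofReal (|x| ^ (p - 1))) ^ ((p + 1) / (p - 1)) :=
      ENNReal.mul_rpow_of_nonneg _ _ (by positivity)
    _ ≤ ENNReal.ofReal c ^ ((p + 1) / (p - 1)) * (2 ^ ((p + 1) / (p - 1) - 1) *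
        (1 ^ ((p + 1) / (p - 1)) + ENNReal.ofReal (|x| ^ (p - 1)) ^ ((p + 1) / (p - 1)))) := by
      gcongr
      exact ENNReal.rpow_add_le_mul_rpow_add_rpow _ _ hQ
    _ = _ := by rw [hpow, ENNReal.one_rpow, mul_assoc]

/-- On a finite measure space, if `0 ≤ g ≤ c₂(1 + |x|^{p-1})` a.e. and
`∫ |x|^{p+1} dm < ∞`, then there is a constant `C` (depending only on `c₂`, `p` and
`m(E)`) with `∑ₖ ∫ g wₖ² dm ≤ C (1 + ∫ |x|^{p+1} dm + (∑ₖ ‖wₖ‖_{p+1}²)^{(p+1)/2})`. -/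
theorem second_derivative_bound_porous_media
    {E : Type*} [MeasurableSpace E] (m : Measure E) [IsFiniteMeasure m]
    (p c₂ : ℝ) (hp : 1 < p) (hc₂ : 0 < c₂) :
    ∃ C : ℝ, ∀ (x g : E → ℝ) (w : ℕ → E → ℝ),
      Measurable x →
      (∫⁻ ξ, ENNReal.ofReal (|x ξ| ^ (p + 1)) ∂m) < ⊤ →
      Measurable g →
      (∀ᵐ ξ ∂m, 0 ≤ g ξ ∧ g ξ ≤ c₂ * (1 + |x ξ| ^ (p - 1))) →
      (∀ k, Measurable (w k)) →
      ∑' k : ℕ, ∫⁻ ξ, ENNReal.ofReal (g ξ * (w k ξ) ^ 2) ∂m ≤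
        ENNReal.ofReal C *
          (1 + (∫⁻ ξ, ENNReal.ofReal (|x ξ| ^ (p + 1)) ∂m) +
            (∑' k : ℕ, (eLpNorm (w k) (ENNReal.ofReal (p + 1)) m) ^ 2)
              ^ ((p + 1) / 2)) := by
  have hp' : 0 < p - 1 := sub_pos.2 hp
  have hconj : ((p + 1) / (p - 1)).HolderConjugate ((p + 1) / 2) := by
    rw [Real.holderConjugate_iff, lt_div_iff₀ hp']
    refine ⟨by linarith, ?_⟩
    field_simp
    ring
  set D : ℝ≥0∞ := ENNReal.ofReal c₂ ^ ((p + 1) / (p - 1)) * 2 ^ ((p + 1) / (p - 1) - 1) with hD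
  have hD_top : D ≠ ⊤ := ENNReal.mul_ne_top
    (ENNReal.rpow_ne_top_of_nonneg hconj.nonneg ENNReal.ofReal_ne_top)
    (ENNReal.rpow_ne_top_of_nonneg hconj.sub_one_pos.le ENNReal.ofNat_ne_top)
  have hC_top : D * m Set.univ + D + 1 ≠ ⊤ := by
    have := ENNReal.mul_ne_top hD_top (measure_ne_top m Set.univ)
    finiteness
  refine ⟨(D * m Set.univ + D + 1).toReal, fun x g w hx _ hg hgx hw ↦ ?_⟩
  rw [ENNReal.ofReal_toReal hC_top]
  set X := ∫⁻ ξ, ENNReal.ofReal (|x ξ| ^ (p + 1)) ∂m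
  set S := (∑' k : ℕ, (eLpNorm (w k) (ENNReal.ofReal (p + 1)) m) ^ 2) ^ ((p + 1) / 2) with hS
  have hG : ∫⁻ ξ, ENNReal.ofReal (g ξ) ^ ((p + 1) / (p - 1)) ∂m ≤ D * (m Set.univ + X) := by
    calc
      _ ≤ ∫⁻ ξ, D * (1 + ENNReal.ofReal (|x ξ| ^ (p + 1))) ∂m :=
        lintegral_mono_ae <| hgx.mono fun ξ hξ ↦
          ofReal_rpow_le_of_le_mul_one_add_rpow hp hc₂.le hξ.2
      _ = _ := by
        rw [lintegral_const_mul' _ _ hD_top, lintegral_add_left measurable_const, lintegral_one]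
  calc
    _ = ∑' k : ℕ, ∫⁻ ξ, ENNReal.ofReal (g ξ) * ENNReal.ofReal (w k ξ ^ 2) ∂m :=
      tsum_congr fun k ↦ lintegral_congr_ae <| hgx.mono fun ξ hξ ↦ ENNReal.ofReal_mul hξ.1
    _ ≤ ∫⁻ ξ, ENNReal.ofReal (g ξ) ^ ((p + 1) / (p - 1)) ∂m + S := by
      simp_rw [hS, ← lintegral_ofReal_sq_rpow_eq_eLpNorm_sq m (by linarith : 0 < p + 1)]
      exact tsum_lintegral_mul_le_lintegral_rpow_add m hconj hg.ennreal_ofReal.aemeasurable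
        fun k ↦ ((hw k).pow_const 2).ennreal_ofReal.aemeasurable
    _ ≤ D * (m Set.univ + X) + S := by gcongr
    _ = D * m Set.univ * 1 + D * X + 1 * S := by ring
    _ ≤ (D * m Set.univ + D + 1) * 1 + (D * m Set.univ + D + 1) * X
        + (D * m Set.univ + D + 1) * S := by
      gcongr
      · exact le_self_add.trans le_self_add
      · exact le_add_self.trans le_self_add
      · exact le_add_self
    _ = _ := by ring
end

section
/- Let r > 2 and c₂ > 0. Let v : E → ℝ be measurable with ∫ |v|^r dm < ∞, let g : E → ℝ be measurable with |g(ξ)| ≤ c₂(1 + |v(ξ)|^{r−2}) for m-a.e. ξ, and let (w_k)_{k∈ℕ} be a sequence of measurable functions E → ℝ. Then there exists a constant C, depending only on c₂, r and m(E), such that ∑_{k=1}^∞ ∫_E g·w_k² dm ≤ C (1 + ∫_E |v|^r dm + (∑_{k=1}^∞ ‖w_k‖_r²)^{r/2}). -/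
open MeasureTheory ENNReal

/-- The Hölder exponents `r / (r - 2)` and `r / 2` are conjugate. -/
lemma Real.holderConjugate_div_sub_two_div_two {r : ℝ} (hr : 2 < r) :
    (r / (r - 2)).HolderConjugate (r / 2) := by
  have h2 : r - 2 ≠ 0 := by linarith
  have h0 : r ≠ 0 := by linarith
  rw [Real.holderConjugate_iff]
  refine ⟨by rw [lt_div_iff₀ (by linarith)]; linarith, ?_⟩
  field_simp
  ring

/-- A bound on the sum of pairings with squares, from Hölder's inequality with exponents
`r / (r - 2)` and `r / 2`. -/
lemma tsum_lintegral_mul_enorm_sq_le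
    {E : Type*} [MeasurableSpace E] {m : Measure E} {r : ℝ} (hr : 2 < r)
    {G : E → ℝ≥0∞} (hG : AEMeasurable G m) {w : ℕ → E → ℝ} (hw : ∀ k, AEMeasurable (w k) m) :
    ∑' k, ∫⁻ ξ, G ξ * ‖w k ξ‖ₑ ^ 2 ∂m ≤
      (∫⁻ ξ, G ξ ^ (r / (r - 2)) ∂m) ^ (1 / (r / (r - 2))) *
        ∑' k, (eLpNorm (w k) (ENNReal.ofReal r) m) ^ 2 := by
  have hpq := Real.holderConjugate_div_sub_two_div_two hr
  rw [← ENNReal.tsum_mul_left]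
  refine ENNReal.tsum_le_tsum fun k => ?_
  refine (ENNReal.lintegral_mul_le_Lp_mul_Lq m hpq hG ((hw k).enorm.pow_const 2)).trans_eq ?_
  rw [eLpNorm_eq_lintegral_rpow_enorm_toReal (by simp; linarith) ofReal_ne_top,
    ENNReal.toReal_ofReal (by linarith), ← ENNReal.rpow_natCast, ← ENNReal.rpow_mul]
  have h (ξ : E) : (‖w k ξ‖ₑ ^ 2) ^ (r / 2) = ‖w k ξ‖ₑ ^ r := by
    rw [← ENNReal.rpow_natCast, ← ENNReal.rpow_mul]
    congr 1
    push_cast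
    ring
  simp only [h]
  congr 2
  push_cast
  field_simp

/-- The `r / (r - 2)`-th moment of `1 + |v| ^ (r - 2)` is controlled by `∫ |v| ^ r`. -/
lemma lintegral_one_add_enorm_rpow_le
    {E : Type*} [MeasurableSpace E] {m : Measure E} {r : ℝ} (hr : 2 < r) (v : E → ℝ) :
    ∫⁻ ξ, (1 + ‖v ξ‖ₑ ^ (r - 2)) ^ (r / (r - 2)) ∂m ≤
      2 ^ (r / (r - 2) - 1) * (m Set.univ + ∫⁻ ξ, ‖v ξ‖ₑ ^ r ∂m) := by
  have hp : 1 ≤ r / (r - 2) := (Real.holderConjugate_div_sub_two_div_two hr).lt.le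
  have h2 : (2 : ℝ≥0∞) ^ (r / (r - 2) - 1) ≠ ⊤ :=
    ENNReal.rpow_ne_top_of_nonneg (by linarith) (by simp)
  calc ∫⁻ ξ, (1 + ‖v ξ‖ₑ ^ (r - 2)) ^ (r / (r - 2)) ∂m
      ≤ ∫⁻ ξ, 2 ^ (r / (r - 2) - 1) * (1 + ‖v ξ‖ₑ ^ r) ∂m := by
        refine lintegral_mono fun ξ => ?_
        refine (ENNReal.rpow_add_le_mul_rpow_add_rpow _ _ hp).trans_eq ?_
        rw [ENNReal.one_rpow, ← ENNReal.rpow_mul, mul_div_cancel₀ r (by linarith)]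
    _ = _ := by
        rw [lintegral_const_mul' _ _ h2, lintegral_add_left measurable_const]
        simp

/-- On a finite measure space, if `|g| ≤ c₂(1 + |v|^{r-2})` a.e. and
`∫ |v|^r dm < ∞`, then there is a constant `C` (depending only on `c₂`, `r` and `m(E)`)
with `∑ₖ ∫ g wₖ² dm ≤ C (1 + ∫ |v|^r dm + (∑ₖ ‖wₖ‖_r²)^{r/2})`. -/
theorem second_derivative_bound_reaction_diffusion
    {E : Type*} [MeasurableSpace E] (m : Measure E) [IsFiniteMeasure m]
    (r c₂ : ℝ) (hr : 2 < r) (hc₂ : 0 < c₂) :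
    ∃ C : ℝ, ∀ (v g : E → ℝ) (w : ℕ → E → ℝ),
      Measurable v →
      (∫⁻ ξ, ENNReal.ofReal (|v ξ| ^ r) ∂m) < ⊤ →
      Measurable g →
      (∀ᵐ ξ ∂m, |g ξ| ≤ c₂ * (1 + |v ξ| ^ (r - 2))) →
      (∀ k, Measurable (w k)) →
      ∑' k : ℕ, ENNReal.ofReal (∫ ξ, g ξ * (w k ξ) ^ 2 ∂m) ≤
        ENNReal.ofReal C *
          (1 + (∫⁻ ξ, ENNReal.ofReal (|v ξ| ^ r) ∂m) +
            (∑' k : ℕ, (eLpNorm (w k) (ENNReal.ofReal r) m) ^ 2) ^ (r / 2)) := by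
  set p := r / (r - 2)
  have hpq : p.HolderConjugate (r / 2) := Real.holderConjugate_div_sub_two_div_two hr
  set D : ℝ≥0∞ := ENNReal.ofReal c₂ * (2 ^ (p - 1) * (m Set.univ + 1) + 1) with hD
  have hDtop : D ≠ ⊤ := by
    have h2 : (2 : ℝ≥0∞) ^ (p - 1) ≠ ⊤ :=
      ENNReal.rpow_ne_top_of_nonneg (by linarith [hpq.lt]) (by simp)
    finiteness
  refine ⟨D.toReal, fun v g w hv _ _ hgv hw => ?_⟩
  rw [ENNReal.ofReal_toReal hDtop]
  have hvr (ξ : E) (s : ℝ) (hs : 0 ≤ s) : ENNReal.ofReal (|v ξ| ^ s) = ‖v ξ‖ₑ ^ s := by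
    rw [← ENNReal.ofReal_rpow_of_nonneg (abs_nonneg _) hs, Real.enorm_eq_ofReal_abs]
  simp only [fun ξ => hvr ξ r (by linarith)]
  set I := ∫⁻ ξ, ‖v ξ‖ₑ ^ r ∂m
  set S := ∑' k : ℕ, (eLpNorm (w k) (ENNReal.ofReal r) m) ^ 2
  set A := ∫⁻ ξ, (1 + ‖v ξ‖ₑ ^ (r - 2)) ^ p ∂m
  have hterm (k : ℕ) : ENNReal.ofReal (∫ ξ, g ξ * (w k ξ) ^ 2 ∂m) ≤
      ENNReal.ofReal c₂ * ∫⁻ ξ, (1 + ‖v ξ‖ₑ ^ (r - 2)) * ‖w k ξ‖ₑ ^ 2 ∂m := by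
    rw [← lintegral_const_mul' _ _ ofReal_ne_top]
    refine (Real.ofReal_le_enorm _).trans ((enorm_integral_le_lintegral_enorm _).trans ?_)
    refine lintegral_mono_ae ?_
    filter_upwards [hgv] with ξ hξ
    rw [enorm_mul, enorm_pow, ← mul_assoc]
    gcongr
    rw [Real.enorm_eq_ofReal_abs]
    refine (ENNReal.ofReal_le_ofReal hξ).trans_eq ?_
    rw [ENNReal.ofReal_mul hc₂.le, ENNReal.ofReal_add zero_le_one (by positivity),
      ENNReal.ofReal_one, hvr ξ _ (by linarith)]
  have hyoung : A ^ (1 / p) * S ≤ A + S ^ (r / 2) := by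
    refine (ENNReal.young_inequality _ _ hpq).trans ?_
    rw [← ENNReal.rpow_mul, one_div_mul_cancel hpq.ne_zero, ENNReal.rpow_one]
    gcongr
    · exact ENNReal.div_le_of_le_mul (le_mul_of_one_le_right' (by simpa using hpq.lt.le))
    · exact ENNReal.div_le_of_le_mul (le_mul_of_one_le_right' (by simpa using hpq.symm.lt.le))
  calc ∑' k : ℕ, ENNReal.ofReal (∫ ξ, g ξ * (w k ξ) ^ 2 ∂m)
      ≤ ENNReal.ofReal c₂ * ∑' k, ∫⁻ ξ, (1 + ‖v ξ‖ₑ ^ (r - 2)) * ‖w k ξ‖ₑ ^ 2 ∂m := by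
        rw [← ENNReal.tsum_mul_left]
        exact ENNReal.tsum_le_tsum hterm
    _ ≤ ENNReal.ofReal c₂ * (A ^ (1 / p) * S) := by
        gcongr
        exact tsum_lintegral_mul_enorm_sq_le hr
          ((hv.enorm.pow_const _).const_add 1).aemeasurable fun k => (hw k).aemeasurable
    _ ≤ ENNReal.ofReal c₂ * (2 ^ (p - 1) * (m Set.univ + I) + S ^ (r / 2)) := by
        gcongr
        refine hyoung.trans ?_
        gcongr
        exact lintegral_one_add_enorm_rpow_le hr v
    _ ≤ ENNReal.ofReal c₂ * (2 ^ (p - 1) * ((m Set.univ + 1) * (1 + I + S ^ (r / 2))) +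
          (1 + I + S ^ (r / 2))) := by
        gcongr
        · calc m Set.univ + I ≤ m Set.univ + I +
                (m Set.univ * (I + S ^ (r / 2)) + 1 + S ^ (r / 2)) := le_self_add
            _ = _ := by ring
        · exact le_add_self
    _ = D * (1 + I + S ^ (r / 2)) := by
        rw [hD]
        ring
end

section
/- Let p ≥ 1 and c₂ > 0, and let Φ : ℝ → ℝ be continuously differentiable with Φ(0) = 0 and 0 ≤ Φ'(r) ≤ c₂(1 + |r|^{p−1}) for all r ∈ ℝ; set Ψ(r) := ∫₀ʳ Φ(s) ds. Then the functional F : L^{p+1}(m) → ℝ, F(x) := ∫_E Ψ(x(ξ)) dm(ξ), is well defined, and at every x ∈ L^{p+1}(m) it is Fréchet differentiable with derivative h ↦ ∫_E Φ(x(ξ)) h(ξ) dm(ξ); that is, there exists a continuous linear map L : L^{p+1}(m) → ℝ with L(h) = ∫_E Φ(x) h dm for all h ∈ L^{p+1}(m) such that F has Fréchet derivative L at x. -/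
open MeasureTheory intervalIntegral

lemma rpow_mul_rpow_le_rpow_add_rpow {u v a b : ℝ} (hu : 0 ≤ u) (hv : 0 ≤ v) (ha : 0 ≤ a)
    (hb : 0 ≤ b) : u ^ a * v ^ b ≤ u ^ (a + b) + v ^ (a + b) := by
  have h1 := Real.rpow_nonneg hu (a + b)
  have h2 := Real.rpow_nonneg hv (a + b)
  rcases le_total u v with h | h
  · calc u ^ a * v ^ b ≤ v ^ a * v ^ b := by gcongr
      _ = v ^ (a + b) := (Real.rpow_add_of_nonneg hv ha hb).symm
      _ ≤ _ := by linarith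
  · calc u ^ a * v ^ b ≤ u ^ a * u ^ b := by gcongr
      _ = u ^ (a + b) := (Real.rpow_add_of_nonneg hu ha hb).symm
      _ ≤ _ := by linarith

lemma add_rpow_le_two_rpow_mul {u v q : ℝ} (hu : 0 ≤ u) (hv : 0 ≤ v) (hq : 0 ≤ q) :
    (u + v) ^ q ≤ 2 ^ q * (u ^ q + v ^ q) := by
  have h1 := Real.rpow_nonneg hu q
  have h2 := Real.rpow_nonneg hv q
  have hmax : (max u v) ^ q ≤ u ^ q + v ^ q := by
    rcases max_choice u v with h | h <;> rw [h] <;> linarith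
  calc (u + v) ^ q ≤ (2 * max u v) ^ q := by
        gcongr
        linarith [le_max_left u v, le_max_right u v]
    _ = 2 ^ q * (max u v) ^ q := Real.mul_rpow (by norm_num) (le_max_of_le_left hu)
    _ ≤ _ := by gcongr

section Scalar

variable {p c : ℝ} {Φ : ℝ → ℝ}

lemma abs_sub_le_of_deriv_growth (hp : 1 ≤ p) (hc : 0 < c) (hΦ : ContDiff ℝ 1 Φ)
    (hΦ' : ∀ r : ℝ, 0 ≤ deriv Φ r ∧ deriv Φ r ≤ c * (1 + |r| ^ (p - 1)))
    {R a b : ℝ} (hR : 1 ≤ R) (ha : |a| ≤ R) (hb : |b| ≤ R) :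
    |Φ b - Φ a| ≤ 2 * c * R ^ (p - 1) * |b - a| := by
  refine Convex.norm_image_sub_le_of_norm_deriv_le (s := Set.Icc (-R) R)
    (fun r _ => (hΦ.differentiable one_ne_zero) r) (fun r hr => ?_) (convex_Icc _ _)
    (abs_le.1 ha) (abs_le.1 hb)
  rw [Real.norm_of_nonneg (hΦ' r).1]
  have h1 : |r| ^ (p - 1) ≤ R ^ (p - 1) :=
    Real.rpow_le_rpow (abs_nonneg r) (abs_le.2 hr) (by linarith)
  have h2 : 1 ≤ R ^ (p - 1) := Real.one_le_rpow hR (by linarith)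
  nlinarith [(hΦ' r).2]

lemma abs_integral_sub_taylor_le (hp : 1 ≤ p) (hc : 0 < c) (hΦ : ContDiff ℝ 1 Φ)
    (hΦ' : ∀ r : ℝ, 0 ≤ deriv Φ r ∧ deriv Φ r ≤ c * (1 + |r| ^ (p - 1)))
    {R a b : ℝ} (hR : 1 ≤ R) (ha : |a| ≤ R) (hb : |b| ≤ R) :
    |(∫ s in (0 : ℝ)..b, Φ s) - (∫ s in (0 : ℝ)..a, Φ s) - Φ a * (b - a)|
      ≤ 2 * c * R ^ (p - 1) * |b - a| ^ 2 := by
  have hint : ∀ u v, IntervalIntegrable Φ volume u v := fun u v =>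
    hΦ.continuous.intervalIntegrable u v
  have heq : (∫ s in (0 : ℝ)..b, Φ s) - (∫ s in (0 : ℝ)..a, Φ s) - Φ a * (b - a)
      = ∫ s in a..b, (Φ s - Φ a) := by
    rw [integral_interval_sub_left (hint _ _) (hint _ _),
      intervalIntegral.integral_sub (hint _ _) intervalIntegrable_const,
      intervalIntegral.integral_const, smul_eq_mul, mul_comm]
  rw [heq, sq, ← mul_assoc]
  rw [← Real.norm_eq_abs]
  refine intervalIntegral.norm_integral_le_of_norm_le_const fun s hs => ?_
  have hs' : s ∈ Set.uIcc a b := Set.uIoc_subset_uIcc hs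
  have hsR : |s| ≤ R := abs_le.2 <|
    Set.uIcc_subset_Icc (abs_le.1 ha) (abs_le.1 hb) hs'
  refine (abs_sub_le_of_deriv_growth hp hc hΦ hΦ' hR ha hsR).trans ?_
  have hRp : 0 ≤ R ^ (p - 1) := Real.rpow_nonneg (by linarith) _
  exact mul_le_mul_of_nonneg_left (Set.abs_sub_left_of_mem_uIcc hs') (by positivity)

end Scalar

section Integral

variable {E : Type*} [MeasurableSpace E] {m : Measure E} {q : ℝ}

lemma MeasureTheory.MemLp.integrable_abs_rpow {f : E → ℝ} (hq : 0 < q)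
    (hf : MemLp f (ENNReal.ofReal q) m) : Integrable (fun ξ => |f ξ| ^ q) m := by
  simpa [ENNReal.toReal_ofReal hq.le] using
    hf.integrable_norm_rpow (by simpa using hq) ENNReal.ofReal_ne_top

lemma MeasureTheory.MemLp.add_abs {r : ENNReal} {f g : E → ℝ} (hf : MemLp f r m)
    (hg : MemLp g r m) : MemLp (fun ξ => f ξ + |g ξ|) r m := by
  simp only [← Real.norm_eq_abs]
  exact hf.add hg.norm

lemma MeasureTheory.Lp.integral_abs_rpow (hq : 0 < q) (f : Lp ℝ (ENNReal.ofReal q) m) :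
    ∫ ξ, |f ξ| ^ q ∂m = ‖f‖ ^ q := by
  have h0 : 0 ≤ ∫ ξ, |f ξ| ^ q ∂m :=
    integral_nonneg fun ξ => Real.rpow_nonneg (abs_nonneg _) _
  rw [Lp.norm_def, (Lp.memLp f).eLpNorm_eq_integral_rpow_norm (by simpa using hq)
    ENNReal.ofReal_ne_top, ENNReal.toReal_ofReal hq.le]
  simp only [Real.norm_eq_abs]
  rw [ENNReal.toReal_ofReal (Real.rpow_nonneg h0 _), Real.rpow_inv_rpow h0 hq.ne']

variable {a b : ℝ}

lemma integrable_abs_rpow_mul_abs_rpow {G h : E → ℝ} (hq : 0 < q) (ha : 0 ≤ a) (hb : 0 ≤ b)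
    (hab : a + b = q) (hG : MemLp G (ENNReal.ofReal q) m) (hh : MemLp h (ENNReal.ofReal q) m) :
    Integrable (fun ξ => |G ξ| ^ a * |h ξ| ^ b) m := by
  refine ((hG.integrable_abs_rpow hq).add (hh.integrable_abs_rpow hq)).mono' ?_
    (Filter.Eventually.of_forall fun ξ => ?_)
  · exact ((hG.1.aemeasurable.abs.pow_const a).mul
      (hh.1.aemeasurable.abs.pow_const b)).aestronglyMeasurable
  · rw [Real.norm_of_nonneg (by positivity), ← hab]
    exact rpow_mul_rpow_le_rpow_add_rpow (abs_nonneg _) (abs_nonneg _) ha hb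

lemma integral_abs_rpow_mul_abs_rpow_le [Fact (1 ≤ ENNReal.ofReal q)] {G : E → ℝ}
    (hq : 0 < q) (ha : 0 ≤ a) (hb : 0 < b)
    (hab : a + b = q) (hG : MemLp G (ENNReal.ofReal q) m) (h : Lp ℝ (ENNReal.ofReal q) m) :
    ∫ ξ, |G ξ| ^ a * |h ξ| ^ b ∂m ≤ (∫ ξ, |G ξ| ^ q ∂m + 1) * ‖h‖ ^ b := by
  have hGi := hG.integrable_abs_rpow hq
  have hhi := (Lp.memLp h).integrable_abs_rpow hq
  rcases (norm_nonneg h).eq_or_lt with hN | hN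
  · have hz : (h : E → ℝ) =ᵐ[m] 0 := by
      have : h = 0 := norm_eq_zero.1 hN.symm
      rw [this]
      exact Lp.coeFn_zero _ _ _
    have hI : ∫ ξ, |G ξ| ^ a * |h ξ| ^ b ∂m = 0 := by
      refine integral_eq_zero_of_ae ?_
      filter_upwards [hz] with ξ hξ
      simp [hξ, Real.zero_rpow hb.ne']
    rw [hI, ← hN, Real.zero_rpow hb.ne', mul_zero]
  · set N := ‖h‖ with hNdef
    have hpt : ∀ ξ, |G ξ| ^ a * |h ξ| ^ b
        ≤ (|G ξ| ^ q + |h ξ| ^ q / N ^ q) * N ^ b := fun ξ => by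
      have hy := rpow_mul_rpow_le_rpow_add_rpow (abs_nonneg (G ξ))
        (div_nonneg (abs_nonneg (h ξ)) hN.le) ha hb.le
      rw [hab, Real.div_rpow (abs_nonneg _) hN.le, Real.div_rpow (abs_nonneg _) hN.le] at hy
      have hNb : 0 < N ^ b := Real.rpow_pos_of_pos hN b
      calc |G ξ| ^ a * |h ξ| ^ b = |G ξ| ^ a * (|h ξ| ^ b / N ^ b) * N ^ b := by field_simp
        _ ≤ _ := by gcongr
    refine (MeasureTheory.integral_mono
      (integrable_abs_rpow_mul_abs_rpow hq ha hb.le hab hG (Lp.memLp h))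
      ((hGi.add (hhi.div_const _)).mul_const _) hpt).trans_eq ?_
    have hNq : N ^ q ≠ 0 := (Real.rpow_pos_of_pos hN q).ne'
    rw [MeasureTheory.integral_mul_const, MeasureTheory.integral_add' hGi (hhi.div_const _),
      MeasureTheory.integral_div,
      Lp.integral_abs_rpow hq, div_self hNq]

end Integral

section Nemytskii

variable {E : Type*} [MeasurableSpace E] {m : Measure E} [IsFiniteMeasure m]
  {p c : ℝ} {Φ : ℝ → ℝ}

lemma memLp_one_add_abs {q : ENNReal} (y : Lp ℝ q m) : MemLp (fun ξ => 1 + |y ξ|) q m :=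
  (memLp_const 1).add_abs (Lp.memLp y)

lemma integrable_primitive_comp_Lp (hp : 1 ≤ p) (hc : 0 < c) (hΦ : ContDiff ℝ 1 Φ)
    (hΦ0 : Φ 0 = 0)
    (hΦ' : ∀ r : ℝ, 0 ≤ deriv Φ r ∧ deriv Φ r ≤ c * (1 + |r| ^ (p - 1)))
    (y : Lp ℝ (ENNReal.ofReal (p + 1)) m) :
    Integrable (fun ξ => ∫ s in (0 : ℝ)..(y ξ), Φ s) m := by
  have hq : 0 < p + 1 := by linarith
  have hΨ : Continuous fun r : ℝ => ∫ s in (0 : ℝ)..r, Φ s :=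
    intervalIntegral.continuous_primitive (fun u v => hΦ.continuous.intervalIntegrable u v) 0
  refine ((integrable_abs_rpow_mul_abs_rpow hq (a := p - 1) (b := 2) (by linarith)
    (by norm_num) (by ring) (memLp_one_add_abs y) (Lp.memLp y)).const_mul (2 * c)).mono'
    (hΨ.comp_aestronglyMeasurable (Lp.aestronglyMeasurable y))
    (Filter.Eventually.of_forall fun ξ => ?_)
  have hn := abs_nonneg (y ξ)
  have := abs_integral_sub_taylor_le hp hc hΦ hΦ' (R := 1 + |y ξ|) (a := 0) (b := y ξ)
    (by linarith) (by rw [abs_zero]; linarith) (by linarith)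
  rw [abs_of_nonneg (show 0 ≤ 1 + |y ξ| by linarith), Real.rpow_two, ← mul_assoc]
  simpa [hΦ0] using this

lemma exists_clm_apply_eq_integral_mul [Fact (1 ≤ ENNReal.ofReal (p + 1))]
    (hp : 1 ≤ p) (hc : 0 < c) (hΦ : ContDiff ℝ 1 Φ) (hΦ0 : Φ 0 = 0)
    (hΦ' : ∀ r : ℝ, 0 ≤ deriv Φ r ∧ deriv Φ r ≤ c * (1 + |r| ^ (p - 1)))
    (x : Lp ℝ (ENNReal.ofReal (p + 1)) m) :
    (∀ h : Lp ℝ (ENNReal.ofReal (p + 1)) m, Integrable (fun ξ => Φ (x ξ) * h ξ) m) ∧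
    ∃ L : Lp ℝ (ENNReal.ofReal (p + 1)) m →L[ℝ] ℝ,
      ∀ h : Lp ℝ (ENNReal.ofReal (p + 1)) m, L h = ∫ ξ, Φ (x ξ) * h ξ ∂m := by
  have hq : 0 < p + 1 := by linarith
  have hΦle : ∀ h : Lp ℝ (ENNReal.ofReal (p + 1)) m, ∀ ξ,
      ‖Φ (x ξ) * h ξ‖ ≤ 2 * c * (|(1 + |x ξ|)| ^ p * |h ξ| ^ (1 : ℝ)) := fun h ξ => by
    have hn := abs_nonneg (x ξ)
    have hb := abs_sub_le_of_deriv_growth hp hc hΦ hΦ' (R := 1 + |x ξ|) (a := 0) (b := x ξ)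
      (by linarith) (by rw [abs_zero]; linarith) (by linarith)
    rw [hΦ0, sub_zero, sub_zero] at hb
    have hpow : (1 + |x ξ|) ^ p = (1 + |x ξ|) ^ (p - 1) * (1 + |x ξ|) := by
      rw [← Real.rpow_add_one (by positivity), sub_add_cancel]
    rw [Real.norm_eq_abs, abs_mul, abs_of_nonneg (show 0 ≤ 1 + |x ξ| by linarith),
      Real.rpow_one, ← mul_assoc, hpow]
    refine mul_le_mul_of_nonneg_right (hb.trans ?_) (abs_nonneg _)
    rw [← mul_assoc]
    gcongr
    linarith
  have hbd : ∀ h : Lp ℝ (ENNReal.ofReal (p + 1)) m,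
      Integrable (fun ξ => 2 * c * (|(1 + |x ξ|)| ^ p * |h ξ| ^ (1 : ℝ))) m := fun h =>
    (integrable_abs_rpow_mul_abs_rpow hq (by linarith) zero_le_one rfl (memLp_one_add_abs x)
      (Lp.memLp h)).const_mul _
  have hΦint : ∀ h : Lp ℝ (ENNReal.ofReal (p + 1)) m,
      Integrable (fun ξ => Φ (x ξ) * h ξ) m := fun h =>
    (hbd h).mono' ((hΦ.continuous.comp_aestronglyMeasurable (Lp.aestronglyMeasurable x)).mul
      (Lp.aestronglyMeasurable h)) (Filter.Eventually.of_forall (hΦle h))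
  let L₀ : Lp ℝ (ENNReal.ofReal (p + 1)) m →ₗ[ℝ] ℝ :=
    { toFun := fun h => ∫ ξ, Φ (x ξ) * h ξ ∂m
      map_add' := fun h k => by
        rw [← MeasureTheory.integral_add (hΦint h) (hΦint k)]
        refine MeasureTheory.integral_congr_ae ?_
        filter_upwards [Lp.coeFn_add h k] with ξ hξ
        simp only [hξ, Pi.add_apply, mul_add]
      map_smul' := fun r h => by
        rw [RingHom.id_apply, smul_eq_mul, ← MeasureTheory.integral_const_mul]
        refine MeasureTheory.integral_congr_ae ?_
        filter_upwards [Lp.coeFn_smul r h] with ξ hξ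
        simp only [hξ, Pi.smul_apply, smul_eq_mul]
        ring }
  let L : Lp ℝ (ENNReal.ofReal (p + 1)) m →L[ℝ] ℝ :=
    L₀.mkContinuous (2 * c * (∫ ξ, |(1 + |x ξ|)| ^ (p + 1) ∂m + 1)) fun h => by
      refine (MeasureTheory.norm_integral_le_of_norm_le (hbd h)
        (Filter.Eventually.of_forall (hΦle h))).trans ?_
      rw [MeasureTheory.integral_const_mul, mul_assoc (2 * c)]
      have := integral_abs_rpow_mul_abs_rpow_le hq (a := p) (by linarith) one_pos rfl
        (memLp_one_add_abs x) h
      rw [Real.rpow_one] at this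
      gcongr
  exact ⟨hΦint, L, fun h => rfl⟩

end Nemytskii

/-- For `Φ ∈ C¹(ℝ)` with `Φ(0) = 0` and `0 ≤ Φ' ≤ c₂(1 + |r|^{p-1})`, the
functional `F(x) = ∫ Ψ(x) dm` with `Ψ(r) = ∫₀ʳ Φ(s) ds` is well defined on `L^{p+1}(m)`
(for a finite measure `m`) and Fréchet differentiable at every `x ∈ L^{p+1}(m)` with
derivative `h ↦ ∫ Φ(x) h dm`. -/
theorem frechet_differentiable_nemytskii
    {E : Type*} [MeasurableSpace E] (m : Measure E) [IsFiniteMeasure m]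
    (p c₂ : ℝ) (hp : 1 ≤ p) (hc₂ : 0 < c₂)
    [Fact (1 ≤ ENNReal.ofReal (p + 1))]
    (Φ : ℝ → ℝ) (hΦ : ContDiff ℝ 1 Φ) (hΦ0 : Φ 0 = 0)
    (hΦ' : ∀ r : ℝ, 0 ≤ deriv Φ r ∧ deriv Φ r ≤ c₂ * (1 + |r| ^ (p - 1))) :
    (∀ y : Lp ℝ (ENNReal.ofReal (p + 1)) m,
        Integrable (fun ξ => ∫ s in (0 : ℝ)..(y ξ), Φ s) m) ∧
    (∀ x : Lp ℝ (ENNReal.ofReal (p + 1)) m,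
      ∃ L : Lp ℝ (ENNReal.ofReal (p + 1)) m →L[ℝ] ℝ,
        (∀ h : Lp ℝ (ENNReal.ofReal (p + 1)) m, L h = ∫ ξ, Φ (x ξ) * h ξ ∂m) ∧
        HasFDerivAt
          (fun y : Lp ℝ (ENNReal.ofReal (p + 1)) m =>
            ∫ ξ, (∫ s in (0 : ℝ)..(y ξ), Φ s) ∂m)
          L x) := by
  have hq : 0 < p + 1 := by linarith
  have hΨint := integrable_primitive_comp_Lp (m := m) hp hc₂ hΦ hΦ0 hΦ'
  refine ⟨hΨint, fun x => ?_⟩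
  obtain ⟨hΦint, L, hL⟩ := exists_clm_apply_eq_integral_mul hp hc₂ hΦ hΦ0 hΦ' x
  refine ⟨L, hL, ?_⟩
  rw [hasFDerivAt_iff_isLittleO_nhds_zero]
  refine Asymptotics.IsBigO.trans_isLittleO (g := fun h => ‖h‖ ^ 2) ?_
    (Asymptotics.isLittleO_norm_pow_id one_lt_two)
  set A := ∫ ξ, |(1 + |x ξ|)| ^ (p + 1) ∂m
  refine Asymptotics.IsBigO.of_bound (2 * c₂ * (2 ^ (p + 1) * (A + 1) + 1)) ?_
  filter_upwards [Metric.closedBall_mem_nhds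
    (0 : Lp ℝ (ENNReal.ofReal (p + 1)) m) one_pos] with h hh
  have hh1 : ‖h‖ ≤ 1 := by simpa using hh
  have hH : MemLp (fun ξ => 1 + |x ξ| + |h ξ|) (ENNReal.ofReal (p + 1)) m :=
    (memLp_one_add_abs x).add_abs (Lp.memLp h)
  have hHle : ∫ ξ, |(1 + |x ξ| + |h ξ|)| ^ (p + 1) ∂m ≤ 2 ^ (p + 1) * (A + 1) := by
    have hGi := (memLp_one_add_abs x).integrable_abs_rpow hq
    have hhi := (Lp.memLp h).integrable_abs_rpow hq
    calc ∫ ξ, |(1 + |x ξ| + |h ξ|)| ^ (p + 1) ∂m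
        ≤ ∫ ξ, 2 ^ (p + 1) * (|(1 + |x ξ|)| ^ (p + 1) + |h ξ| ^ (p + 1)) ∂m := by
          refine MeasureTheory.integral_mono (hH.integrable_abs_rpow hq) ((hGi.add hhi).const_mul _)
            fun ξ => ?_
          have hx0 : 0 ≤ 1 + |x ξ| := by positivity
          have hxh0 : 0 ≤ 1 + |x ξ| + |h ξ| := by positivity
          simp only [abs_of_nonneg hx0, abs_of_nonneg hxh0]
          exact add_rpow_le_two_rpow_mul hx0 (abs_nonneg _) hq.le
      _ = 2 ^ (p + 1) * (A + ‖h‖ ^ (p + 1)) := by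
          rw [MeasureTheory.integral_const_mul, MeasureTheory.integral_add hGi hhi,
            Lp.integral_abs_rpow hq]
      _ ≤ _ := by
          gcongr
          exact Real.rpow_le_one (norm_nonneg _) hh1 hq.le
  rw [hL h, ← MeasureTheory.integral_sub (hΨint _) (hΨint x),
    ← MeasureTheory.integral_sub (by exact (hΨint _).sub (hΨint x)) (hΦint h)]
  have hrem := integral_abs_rpow_mul_abs_rpow_le hq (a := p - 1) (b := 2) (by linarith)
    two_pos (by ring) hH h
  have hremi := (integrable_abs_rpow_mul_abs_rpow hq (a := p - 1) (b := 2) (by linarith)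
    (by norm_num) (by ring) hH (Lp.memLp h)).const_mul (2 * c₂)
  refine (MeasureTheory.norm_integral_le_of_norm_le hremi ?_).trans ?_
  · filter_upwards [Lp.coeFn_add x h] with ξ hξ
    have hx := abs_nonneg (x ξ)
    have hhn := abs_nonneg (h ξ)
    have := abs_integral_sub_taylor_le hp hc₂ hΦ hΦ' (R := 1 + |x ξ| + |h ξ|) (a := x ξ)
      (b := x ξ + h ξ) (by linarith) (by linarith) ((abs_add_le _ _).trans (by linarith))
    rw [add_sub_cancel_left] at this
    rw [hξ, abs_of_nonneg (show 0 ≤ 1 + |x ξ| + |h ξ| by linarith), Real.rpow_two, ← mul_assoc]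
    exact this
  · rw [MeasureTheory.integral_const_mul, norm_pow, norm_norm, mul_assoc (2 * c₂)]
    rw [Real.rpow_two] at hrem
    gcongr
    exact hrem.trans (by gcongr)
end
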